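/- arXiv:math/0605032 — 5 statements merged into one kernel-verified Lean document; each statement's English description precedes it below -/
import Mathlib

section
/- Let p>1, c>0 and A = ((p+1)c/2)^{1/(p-1)}. Then ∫_ℝ Q_c'(x)² dx = (2/(p−1)) · √c · A² · B(2/(p−1), 3/2), where B denotes the Euler Beta function. -/
open MeasureTheory Real Filter

/-- The 1D soliton profile `Q_c`. -/
noncomputable def Qc (p c : ℝ) : ℝ → ℝ := fun x =>
  ((p + 1) * c / 2) ^ (1 / (p - 1)) *
    (1 / Real.cosh ((p - 1) * Real.sqrt c * x / 2)) ^ (2 / (p - 1))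

/-- The Euler Beta function `B(a,b) = ∫₀¹ t^{a-1}(1-t)^{b-1} dt`. -/
noncomputable def eulerBeta (a b : ℝ) : ℝ :=
  ∫ t in (0:ℝ)..1, t ^ (a - 1) * (1 - t) ^ (b - 1)

/-- The substitution `t = sech² y` sends `(0, ∞)` onto `(0, 1)`. -/
lemma image_sq_one_div_cosh :
    (fun y : ℝ => (1 / Real.cosh y) ^ 2) '' Set.Ioi 0 = Set.Ioo 0 1 := by
  ext t
  constructor
  · rintro ⟨y, hy, rfl⟩
    have h1 : 1 < Real.cosh y := Real.one_lt_cosh.2 (ne_of_gt hy)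
    have h0 : 0 < Real.cosh y := Real.cosh_pos y
    refine ⟨by positivity, ?_⟩
    have : 1 / Real.cosh y < 1 := by rwa [div_lt_one h0]
    exact pow_lt_one₀ (by positivity) this two_ne_zero
  · rintro ⟨h0, h1⟩
    have hs : 0 < √t := Real.sqrt_pos.2 h0
    have hs1 : √t < 1 := by rw [Real.sqrt_lt' one_pos]; simpa using h1
    have hlt : 1 < 1 / √t := by rwa [lt_div_iff₀ hs, one_mul]
    refine ⟨Real.arcosh (1 / √t), Real.arcosh_pos hlt, ?_⟩
    simp only [Real.cosh_arcosh hlt.le, one_div_one_div]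
    exact Real.sq_sqrt h0.le

lemma injOn_sq_one_div_cosh :
    Set.InjOn (fun y : ℝ => (1 / Real.cosh y) ^ 2) (Set.Ioi 0) := by
  intro x hx y hy h
  have hx0 := Real.cosh_pos x
  have hy0 := Real.cosh_pos y
  have h' : 1 / Real.cosh x = 1 / Real.cosh y :=
    (pow_left_inj₀ (by positivity) (by positivity) two_ne_zero).1 h
  rw [one_div, one_div, inv_inj] at h'
  exact Real.cosh_injOn (Set.mem_Ici.2 (le_of_lt hx)) (Set.mem_Ici.2 (le_of_lt hy)) h'

lemma hasDerivAt_one_div_cosh (y : ℝ) :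
    HasDerivAt (fun y : ℝ => 1 / Real.cosh y) (-Real.sinh y / Real.cosh y ^ 2) y := by
  simpa only [one_div] using (Real.hasDerivAt_cosh y).fun_inv (Real.cosh_pos y).ne'

lemma integral_sech_rpow_sq_mul_tanh_sq (q : ℝ) :
    ∫ y : ℝ, ((1 / Real.cosh y) ^ q) ^ 2 * (Real.sinh y / Real.cosh y) ^ 2 =
      eulerBeta q (3 / 2) := by
  have heven : ∀ y : ℝ, ((1 / Real.cosh y) ^ q) ^ 2 * (Real.sinh y / Real.cosh y) ^ 2 =
      (fun z : ℝ => ((1 / Real.cosh z) ^ q) ^ 2 * (Real.sinh z / Real.cosh z) ^ 2) |y| := by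
    intro y
    simp only [Real.cosh_abs, div_pow, Real.sinh_sq]
  rw [integral_congr_ae (ae_of_all _ heven),
    integral_comp_abs (f := fun z => ((1 / Real.cosh z) ^ q) ^ 2 *
      (Real.sinh z / Real.cosh z) ^ 2), eulerBeta,
    intervalIntegral.integral_of_le zero_le_one, integral_Ioc_eq_integral_Ioo,
    ← image_sq_one_div_cosh,
    integral_image_eq_integral_abs_deriv_smul measurableSet_Ioi
      (fun y _ => ((hasDerivAt_one_div_cosh y).fun_pow 2).hasDerivWithinAt)
      injOn_sq_one_div_cosh, ← integral_const_mul]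
  refine setIntegral_congr_fun measurableSet_Ioi fun y hy => ?_
  have hc : 0 < Real.cosh y := Real.cosh_pos y
  have hs : 0 < Real.sinh y := Real.sinh_pos_iff.2 hy
  have hsech : 0 < 1 / Real.cosh y := by positivity
  have htanh : (1 - (1 / Real.cosh y) ^ 2) ^ ((3 / 2 : ℝ) - 1) = Real.sinh y / Real.cosh y := by
    have : 1 - (1 / Real.cosh y) ^ 2 = (Real.sinh y / Real.cosh y) ^ 2 := by
      rw [div_pow, div_pow, Real.sinh_sq]
      field_simp
    rw [this, show (3 / 2 : ℝ) - 1 = 1 / 2 by norm_num, ← Real.sqrt_eq_rpow,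
      Real.sqrt_sq (by positivity)]
  have hpow : ((1 / Real.cosh y) ^ 2) ^ (q - 1) =
      ((1 / Real.cosh y) ^ q) ^ 2 * Real.cosh y ^ 2 := by
    rw [Real.rpow_sub_one (by positivity), ← Real.rpow_natCast_mul hsech.le,
      ← Real.rpow_mul_natCast hsech.le, mul_comm q]
    field_simp
  have habs : |((2 : ℕ) : ℝ) * (1 / Real.cosh y) ^ (2 - 1) *
      (-Real.sinh y / Real.cosh y ^ 2)| = 2 * Real.sinh y / Real.cosh y ^ 3 := by
    rw [abs_of_nonpos]
    · field_simp
      norm_num [hc.ne']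
    · rw [neg_div, mul_neg, neg_nonpos]
      positivity
  simp only [smul_eq_mul]
  rw [habs, htanh, hpow]
  field_simp

lemma deriv_Qc (p c : ℝ) (hp : 1 < p) (x : ℝ) :
    deriv (Qc p c) x = -(((p + 1) * c / 2) ^ (1 / (p - 1)) * √c *
      ((1 / Real.cosh ((p - 1) * √c / 2 * x)) ^ (2 / (p - 1)) *
        (Real.sinh ((p - 1) * √c / 2 * x) / Real.cosh ((p - 1) * √c / 2 * x)))) := by
  have hp' : p - 1 ≠ 0 := by linarith
  set k := (p - 1) * √c / 2 with hk
  have hcosh : 0 < Real.cosh (k * x) := Real.cosh_pos _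
  have hsech : 0 < 1 / Real.cosh (k * x) := by positivity
  have hQ : Qc p c = fun x => ((p + 1) * c / 2) ^ (1 / (p - 1)) *
      (1 / Real.cosh (k * x)) ^ (2 / (p - 1)) := by
    funext x
    rw [Qc, show (p - 1) * √c * x / 2 = k * x by rw [hk]; ring]
  have hlin : HasDerivAt (fun x : ℝ => k * x) k x := by
    simpa using (hasDerivAt_id x).const_mul k
  have hd := (((hasDerivAt_one_div_cosh (k * x)).comp x hlin).rpow_const
    (p := 2 / (p - 1)) (Or.inl hsech.ne')).const_mul (((p + 1) * c / 2) ^ (1 / (p - 1)))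
  rw [hQ]
  refine hd.deriv.trans ?_
  simp only [Function.comp_apply]
  rw [Real.rpow_sub_one hsech.ne']
  have hqk : 2 / (p - 1) * k = √c := by rw [hk]; field_simp
  rw [← hqk]
  field_simp

theorem stmt1 (p c : ℝ) (hp : 1 < p) (hc : 0 < c) (A : ℝ)
    (hA : A = ((p + 1) * c / 2) ^ (1 / (p - 1))) :
    ∫ x : ℝ, (deriv (Qc p c) x) ^ 2 =
      (2 / (p - 1)) * Real.sqrt c * A ^ 2 * eulerBeta (2 / (p - 1)) (3 / 2) := by
  have hp' : 0 < p - 1 := by linarith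
  have hsc : 0 < √c := Real.sqrt_pos.2 hc
  have hk : 0 < (p - 1) * √c / 2 := by positivity
  have hsq : ∀ x : ℝ, (deriv (Qc p c) x) ^ 2 = A ^ 2 * √c ^ 2 *
      (fun y : ℝ => ((1 / Real.cosh y) ^ (2 / (p - 1))) ^ 2 *
        (Real.sinh y / Real.cosh y) ^ 2) ((p - 1) * √c / 2 * x) := by
    intro x
    rw [deriv_Qc p c hp, ← hA]
    ring
  rw [integral_congr_ae (ae_of_all _ hsq), integral_const_mul,
    Measure.integral_comp_mul_left (fun y : ℝ => ((1 / Real.cosh y) ^ (2 / (p - 1))) ^ 2 *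
      (Real.sinh y / Real.cosh y) ^ 2), integral_sech_rpow_sq_mul_tanh_sq,
    abs_of_pos (inv_pos.2 hk), smul_eq_mul]
  field_simp
end

section
/- Let p>1, ω>0, α₀>0 and set c = ω + α₀^{−2}. If ∫_ℝ ( Q_c'(x)² − α₀^{−2} Q_c(x)² ) dx = 0, then c = (p+3)ω/4 and α₀ = 2/√((p−1)ω). -/
open MeasureTheory Real Filter

theorem integrable_exp_neg_mul_log_cosh {a k : ℝ} (ha : 0 < a) (hk : 0 < k) :
    Integrable fun x : ℝ => exp (-a * log (cosh (k * x))) := by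
  have hcont : Continuous fun x : ℝ => exp (-a * log (cosh (k * x))) :=
    continuous_exp.comp (continuous_const.mul
      ((continuous_cosh.comp (continuous_const.mul continuous_id)).log
        fun x => (cosh_pos _).ne'))
  refine hcont.locallyIntegrable.integrable_of_isBigO_atTop_of_norm_isNegInvariant
    (g := fun x => exp (-(a * k) * x)) ?_ ?_ ?_
  · exact Eventually.of_forall fun x => by simp
  · refine Asymptotics.IsBigO.of_bound (exp (a * log 2)) (Eventually.of_forall fun x => ?_)
    have hlog : k * x - log 2 ≤ log (cosh (k * x)) := by
      rw [le_log_iff_exp_le (cosh_pos _), exp_sub, exp_log two_pos, cosh_eq]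
      have := exp_pos (-(k * x))
      linarith
    simp only [norm_eq_abs, abs_exp]
    rw [← exp_add, exp_le_exp]
    nlinarith
  · exact ⟨Set.Ioi 0, Ioi_mem_atTop 0, exp_neg_integrableOn_Ioi 0 (mul_pos ha hk)⟩

theorem Qc_eq_exp (p c x : ℝ) :
    Qc p c x = ((p + 1) * c / 2) ^ (1 / (p - 1)) *
      exp (-(2 / (p - 1)) * log (cosh ((p - 1) * √c / 2 * x))) := by
  have harg : (p - 1) * √c * x / 2 = (p - 1) * √c / 2 * x := by ring
  rw [Qc, harg, rpow_def_of_pos (one_div_pos.2 (cosh_pos _)), one_div (cosh _), log_inv]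
  ring_nf

theorem hasDerivAt_tanh (x : ℝ) : HasDerivAt tanh (1 - tanh x ^ 2) x := by
  have h := (hasDerivAt_sinh x).div (hasDerivAt_cosh x) (cosh_pos x).ne'
  have hfun : sinh / cosh = tanh := funext fun y => (tanh_eq_sinh_div_cosh y).symm
  rw [hfun] at h
  refine h.congr_deriv ?_
  rw [tanh_eq_sinh_div_cosh]
  field_simp [(cosh_pos x).ne']

theorem hasDerivAt_Qc {p : ℝ} (hp : 1 < p) (c x : ℝ) :
    HasDerivAt (Qc p c) (-√c * tanh ((p - 1) * √c / 2 * x) * Qc p c x) x := by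
  have hp' : p - 1 ≠ 0 := by linarith
  have hlin : HasDerivAt (fun y : ℝ => (p - 1) * √c / 2 * y) ((p - 1) * √c / 2) x := by
    simpa using (hasDerivAt_id x).const_mul ((p - 1) * √c / 2)
  have h := ((((hlin.cosh).log (cosh_pos _).ne').const_mul (-(2 / (p - 1)))).exp).const_mul
    (((p + 1) * c / 2) ^ (1 / (p - 1)))
  rw [funext (Qc_eq_exp p c)]
  refine h.congr_deriv ?_
  rw [tanh_eq_sinh_div_cosh]
  field_simp

theorem integrable_Qc_sq {p c : ℝ} (hp : 1 < p) (hc : 0 < c) :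
    Integrable fun x => Qc p c x ^ 2 := by
  have hp' : 0 < p - 1 := by linarith
  have hk : 0 < (p - 1) * √c / 2 := by positivity
  refine ((integrable_exp_neg_mul_log_cosh (a := 2 * (2 / (p - 1))) (by positivity) hk).const_mul
    ((((p + 1) * c / 2) ^ (1 / (p - 1))) ^ 2)).congr (Eventually.of_forall fun x => ?_)
  simp only [Qc_eq_exp, mul_pow, ← exp_nat_mul]
  congr 2
  push_cast
  ring

theorem Qc_pos {p c : ℝ} (hp : 1 < p) (hc : 0 < c) (x : ℝ) : 0 < Qc p c x := by
  rw [Qc_eq_exp]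
  positivity

theorem integral_Qc_sq_pos {p c : ℝ} (hp : 1 < p) (hc : 0 < c) :
    0 < ∫ x, Qc p c x ^ 2 := by
  have hpos : ∀ x, 0 < Qc p c x ^ 2 := fun x => pow_pos (Qc_pos hp hc x) 2
  rw [integral_pos_iff_support_of_nonneg (fun x => (hpos x).le) (integrable_Qc_sq hp hc),
    Function.support_eq_univ fun x => (hpos x).ne']
  simp

theorem integrable_tanh_pow_mul_Qc_sq {p c : ℝ} (hp : 1 < p) (hc : 0 < c) (k : ℝ) (n : ℕ) :
    Integrable fun x => tanh (k * x) ^ n * Qc p c x ^ 2 := by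
  have htanh : Continuous tanh :=
    continuous_iff_continuousAt.2 fun x => (hasDerivAt_tanh x).continuousAt
  refine (integrable_Qc_sq hp hc).bdd_mul (c := 1)
    ((htanh.comp (continuous_const.mul continuous_id)).pow n).aestronglyMeasurable
    (Eventually.of_forall fun x => ?_)
  rw [norm_pow]
  exact pow_le_one₀ (norm_nonneg _) (abs_tanh_lt_one _).le

/-- The kinetic energy of the soliton in terms of its mass. -/
theorem integral_deriv_Qc_sq {p c : ℝ} (hp : 1 < p) (hc : 0 < c) :
    Integrable (fun x => deriv (Qc p c) x ^ 2) ∧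
      (p + 3) * ∫ x, deriv (Qc p c) x ^ 2 = (p - 1) * c * ∫ x, Qc p c x ^ 2 := by
  have hs : 0 < √c := sqrt_pos.2 hc
  set k := (p - 1) * √c / 2 with hk
  have hderiv : (fun x => deriv (Qc p c) x ^ 2) =
      fun x => c * (tanh (k * x) ^ 2 * Qc p c x ^ 2) := by
    funext x
    rw [(hasDerivAt_Qc hp c x).deriv, ← hk, mul_pow, mul_pow, neg_sq, sq_sqrt hc.le, mul_assoc]
  have hint := integrable_Qc_sq hp hc
  have hint2 := integrable_tanh_pow_mul_Qc_sq hp hc k 2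
  rw [hderiv]
  refine ⟨hint2.const_mul c, ?_⟩
  have hF : ∀ x, HasDerivAt (fun y => tanh (k * y) ^ 1 * Qc p c y ^ 2)
      (k * Qc p c x ^ 2 - (k + 2 * √c) * (tanh (k * x) ^ 2 * Qc p c x ^ 2)) x := by
    intro x
    have hlin : HasDerivAt (fun y : ℝ => k * y) k x := by
      simpa using (hasDerivAt_id x).const_mul k
    have h := (((hasDerivAt_tanh (k * x)).comp x hlin).pow 1).mul ((hasDerivAt_Qc hp c x).pow 2)
    refine h.congr_deriv ?_
    simp [← hk]
    ring
  have hzero := integral_eq_zero_of_hasDerivAt_of_integrable hF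
    ((hint.const_mul k).sub (hint2.const_mul (k + 2 * √c)))
    (integrable_tanh_pow_mul_Qc_sq hp hc k 1)
  rw [integral_sub (hint.const_mul k) (hint2.const_mul _), integral_const_mul,
    integral_const_mul] at hzero
  rw [integral_const_mul]
  refine mul_left_cancel₀ hs.ne' ?_
  rw [hk] at hzero ⊢
  linear_combination (-2 * c) * hzero

theorem stmt3 (p ω α₀ : ℝ) (hp : 1 < p) (hω : 0 < ω) (hα : 0 < α₀)
    (c : ℝ) (hc : c = ω + (α₀ ^ 2)⁻¹)
    (h : ∫ x : ℝ, ((deriv (Qc p c) x) ^ 2 - (α₀ ^ 2)⁻¹ * (Qc p c x) ^ 2) = 0) :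
    c = (p + 3) * ω / 4 ∧ α₀ = 2 / Real.sqrt ((p - 1) * ω) := by
  have hc0 : 0 < c := by rw [hc]; positivity
  obtain ⟨hint, hkin⟩ := integral_deriv_Qc_sq hp hc0
  rw [integral_sub hint ((integrable_Qc_sq hp hc0).const_mul _), integral_const_mul] at h
  have hcoef : (p - 1) * c = (p + 3) * (α₀ ^ 2)⁻¹ := by
    refine mul_right_cancel₀ (integral_Qc_sq_pos hp hc0).ne' ?_
    linear_combination (p + 3) * h - hkin
  have hβ : (α₀ ^ 2)⁻¹ = (p - 1) * ω / 4 := by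
    rw [hc] at hcoef
    linarith
  refine ⟨by rw [hc, hβ]; ring, ?_⟩
  have hsq : (p - 1) * ω = (2 / α₀) ^ 2 := by
    rw [div_pow, div_eq_mul_inv, hβ]
    ring
  rw [hsq, sqrt_sq (by positivity)]
  field_simp
end

section
/- Let p>1, c>0 and λ₀ = (p−1)(p+3)/4. Then the function u = Q_c^{(p+1)/2} satisfies u''(x) − c·u(x) + p·Q_c(x)^{p−1}·u(x) = λ₀·c·u(x) for all x ∈ ℝ; that is, Q_c^{(p+1)/2} is an eigenfunction of L_c with eigenvalue λ₀c. -/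
open MeasureTheory Real Filter

theorem hasDerivAt_cosh_mul (k x : ℝ) :
    HasDerivAt (fun x => Real.cosh (k * x)) (k * Real.sinh (k * x)) x := by
  simpa [mul_comm] using ((hasDerivAt_id x).const_mul k).cosh

theorem hasDerivAt_cosh_mul_rpow (k r x : ℝ) :
    HasDerivAt (fun x => Real.cosh (k * x) ^ r)
      (k * r * (Real.cosh (k * x) ^ (r - 1) * Real.sinh (k * x))) x := by
  convert (hasDerivAt_cosh_mul k x).rpow_const (p := r) (Or.inl (Real.cosh_pos _).ne') using 1
  ring

theorem deriv_deriv_const_mul_cosh_mul_rpow (A k r x : ℝ) :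
    deriv (deriv fun x => A * Real.cosh (k * x) ^ r) x =
      A * Real.cosh (k * x) ^ r * (k ^ 2 * (r ^ 2 - r * (r - 1) / Real.cosh (k * x) ^ 2)) := by
  have hsinh : HasDerivAt (fun x => Real.sinh (k * x)) (k * Real.cosh (k * x)) x := by
    simpa [mul_comm] using ((hasDerivAt_id x).const_mul k).sinh
  have hfirst : deriv (fun x => A * Real.cosh (k * x) ^ r) = fun x =>
      A * (k * r * (Real.cosh (k * x) ^ (r - 1) * Real.sinh (k * x))) :=
    funext fun y => ((hasDerivAt_cosh_mul_rpow k r y).const_mul A).deriv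
  have hsecond := ((((hasDerivAt_cosh_mul_rpow k (r - 1) x).mul hsinh).const_mul
    (k * r)).const_mul A).deriv
  have hpos := Real.cosh_pos (k * x)
  have hsq := Real.sinh_sq (k * x)
  rw [hfirst]
  refine hsecond.trans ?_
  rw [Real.rpow_sub_one hpos.ne', Real.rpow_sub_one hpos.ne']
  field_simp
  rw [hsq]
  ring

theorem Qc_rpow {p c : ℝ} (hp : 1 < p) (hc : 0 < c) (s x : ℝ) :
    Qc p c x ^ s = ((p + 1) * c / 2) ^ (s / (p - 1)) *
      Real.cosh ((p - 1) * Real.sqrt c / 2 * x) ^ (-(2 * s / (p - 1))) := by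
  have hcosh := Real.cosh_pos ((p - 1) * Real.sqrt c / 2 * x)
  have hK : 0 < (p + 1) * c / 2 := by positivity
  have harg : (p - 1) * Real.sqrt c * x / 2 = (p - 1) * Real.sqrt c / 2 * x := by ring
  unfold Qc
  rw [harg, Real.mul_rpow (by positivity) (by positivity), ← Real.rpow_mul hK.le,
    ← Real.rpow_mul (by positivity), one_div (Real.cosh _), Real.inv_rpow hcosh.le,
    ← Real.rpow_neg hcosh.le]
  congr 2 <;> ring

theorem stmt5 (p c : ℝ) (hp : 1 < p) (hc : 0 < c) (lam₀ : ℝ)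
    (hlam : lam₀ = (p - 1) * (p + 3) / 4)
    (u : ℝ → ℝ) (hu : u = fun x => Qc p c x ^ ((p + 1) / 2)) :
    ∀ x : ℝ,
      deriv (deriv u) x - c * u x + p * Qc p c x ^ (p - 1) * u x = lam₀ * c * u x := by
  intro x
  have hp' : p - 1 ≠ 0 := sub_ne_zero.mpr hp.ne'
  have hpow : Qc p c x ^ (p - 1) =
      (p + 1) * c / 2 / Real.cosh ((p - 1) * Real.sqrt c / 2 * x) ^ 2 := by
    rw [Qc_rpow hp hc, mul_div_assoc 2, div_self hp', Real.rpow_one,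
      Real.rpow_neg (Real.cosh_pos _).le, mul_one, Real.rpow_two, ← div_eq_mul_inv]
  have hk : ((p - 1) * Real.sqrt c / 2) ^ 2 = (p - 1) ^ 2 * c / 4 := by
    rw [div_pow, mul_pow, Real.sq_sqrt hc.le]
    norm_num
  simp only [Qc_rpow hp hc] at hu
  rw [hpow, hu, deriv_deriv_const_mul_cosh_mul_rpow, hk, hlam]
  have hcosh := (Real.cosh_pos ((p - 1) * Real.sqrt c / 2 * x)).ne'
  field_simp
  ring
end

section
/- Let ω>0 and ε>0. For every smooth function w : (0,∞) → ℝ with compact support contained in (0,∞), one has ∫₀^∞ ( w''(r) + w'(r)/r − ω·w(r) − (εr)^{−2}·w(r) )² r dr ≥ ∫₀^∞ ( ω·w(r) − w''(r) − w'(r)/r )² r dr + (ε^{−4} − 4ε^{−2}) ∫₀^∞ r^{−4} w(r)² r dr. -/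
open MeasureTheory Real Filter

/-- Dividing a smooth function supported away from the nonpositive axis by `r` keeps it smooth. -/
lemma contDiff_div_id_of_tsupport_subset_Ioi {f : ℝ → ℝ} (hf : ContDiff ℝ (⊤ : ℕ∞) f)
    (hs : tsupport f ⊆ Set.Ioi 0) : ContDiff ℝ (⊤ : ℕ∞) fun r => f r / r := by
  rw [contDiff_iff_contDiffAt]
  intro x
  by_cases hx : x ∈ tsupport f
  · exact hf.contDiffAt.div contDiffAt_id (hs hx).ne'
  · have h : (fun r => f r / r) =ᶠ[nhds x] fun _ => 0 := by
      filter_upwards [notMem_tsupport_iff_eventuallyEq.mp hx] with r hr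
      simp [hr]
    exact contDiffAt_const.congr_of_eventuallyEq h

lemma tsupport_div_id_subset (f : ℝ → ℝ) : tsupport (fun r => f r / r) ⊆ tsupport f :=
  closure_mono fun r hr h => hr (by simp [h])

theorem stmt11 (ω ε : ℝ) (hω : 0 < ω) (hε : 0 < ε) (w : ℝ → ℝ)
    (hw : ContDiff ℝ (⊤ : ℕ∞) w) (hsupp : HasCompactSupport w)
    (hsupp' : tsupport w ⊆ Set.Ioi 0) :
    ∫ r in Set.Ioi (0:ℝ),
        (deriv (deriv w) r + deriv w r / r - ω * w r - ((ε * r) ^ 2)⁻¹ * w r) ^ 2 * r ≥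
      (∫ r in Set.Ioi (0:ℝ),
          (ω * w r - deriv (deriv w) r - deriv w r / r) ^ 2 * r) +
        ((ε ^ 4)⁻¹ - 4 * (ε ^ 2)⁻¹) *
          ∫ r in Set.Ioi (0:ℝ), (r ^ 4)⁻¹ * w r ^ 2 * r := by
  have hw1 : ContDiff ℝ (⊤ : ℕ∞) (deriv w) := (contDiff_infty_iff_deriv.mp hw).2
  have hw2 : ContDiff ℝ (⊤ : ℕ∞) (deriv (deriv w)) := (contDiff_infty_iff_deriv.mp hw1).2
  have hs1 : tsupport (deriv w) ⊆ Set.Ioi 0 := tsupport_deriv_subset.trans hsupp'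
  have hv := contDiff_div_id_of_tsupport_subset_Ioi hw hsupp'
  have hvs := (tsupport_div_id_subset w).trans hsupp'
  have hu := contDiff_div_id_of_tsupport_subset_Ioi hv hvs
  have hp := contDiff_div_id_of_tsupport_subset_Ioi hw1 hs1
  have cv : HasCompactSupport fun r => w r / r :=
    hsupp.mono' ((subset_tsupport _).trans (tsupport_div_id_subset w))
  have cu : HasCompactSupport fun r => w r / r / r :=
    cv.mono' ((subset_tsupport _).trans (tsupport_div_id_subset _))
  have c1 : HasCompactSupport (deriv w) := hsupp.deriv
  have c2 : HasCompactSupport (deriv (deriv w)) := c1.deriv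
  have cp : HasCompactSupport fun r => deriv w r / r :=
    c1.mono' ((subset_tsupport _).trans (tsupport_div_id_subset _))
  let G : ℝ → ℝ := fun r => w r / r * deriv w r + w r / r * (w r / r)
  have hG : ContDiff ℝ (⊤ : ℕ∞) G := (hv.mul hw1).add (hv.mul hv)
  have cG : HasCompactSupport G := (cv.mul_right).add (cv.mul_right)
  have hG0 : ∫ r in Set.Ioi (0:ℝ), deriv G r = 0 := by
    rw [cG.integral_Ioi_deriv_eq (hG.of_le (by exact_mod_cast le_top)) 0]
    simp [G]
  have hGd : ∀ r ∈ Set.Ioi (0:ℝ), deriv G r =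
      (deriv w r / r - w r / r ^ 2) * deriv w r + w r / r * deriv (deriv w) r
        + 2 * (w r / r) * (deriv w r / r - w r / r ^ 2) := by
    intro r hr
    have hr0 : r ≠ 0 := (Set.mem_Ioi.mp hr).ne'
    have d0 := (hw.differentiable (by simp) r).hasDerivAt
    have d1 := (hw1.differentiable (by simp) r).hasDerivAt
    have dv := d0.div (hasDerivAt_id r) hr0
    have dG : HasDerivAt G _ r := (dv.mul d1).add (dv.mul dv)
    rw [dG.deriv]
    simp only [id, Pi.div_apply]
    field_simp
    ring
  have iG : IntegrableOn (deriv G) (Set.Ioi 0) :=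
    ((contDiff_infty_iff_deriv.mp hG).2.continuous.integrable_of_hasCompactSupport
      cG.deriv).integrableOn
  have iA : IntegrableOn (fun r => (ω * w r - deriv (deriv w) r - deriv w r / r) ^ 2 * r)
      (Set.Ioi 0) := by
    have c : HasCompactSupport fun r => ω * w r - deriv (deriv w) r - deriv w r / r :=
      (hsupp.mul_left.sub c2).sub cp
    have h : ContDiff ℝ (⊤ : ℕ∞) fun r => ω * w r - deriv (deriv w) r - deriv w r / r :=
      ((contDiff_const.mul hw).sub hw2).sub hp
    refine Integrable.integrableOn (Continuous.integrable_of_hasCompactSupport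
      ((h.continuous.pow 2).mul continuous_id) ?_)
    simp only [pow_two, mul_assoc]
    exact c.mul_right
  have iB : IntegrableOn (fun r => (r ^ 4)⁻¹ * w r ^ 2 * r) (Set.Ioi 0) := by
    have h : IntegrableOn (fun r => w r / r / r * (w r / r)) (Set.Ioi 0) :=
      Integrable.integrableOn (Continuous.integrable_of_hasCompactSupport
        (hu.continuous.mul hv.continuous) cu.mul_right)
    refine h.congr_fun (fun r hr => ?_) measurableSet_Ioi
    have hr0 : r ≠ 0 := (Set.mem_Ioi.mp hr).ne'
    field_simp
  have iQ : IntegrableOn (fun r => ω * (w r * (w r / r)) + deriv w r * (deriv w r / r))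
      (Set.Ioi 0) :=
    Integrable.integrableOn (Continuous.integrable_of_hasCompactSupport
      ((continuous_const.mul (hw.continuous.mul hv.continuous)).add
        (hw1.continuous.mul hp.continuous))
      (HasCompactSupport.add (hsupp.mul_right.mul_left) c1.mul_right))
  have hQ : 0 ≤ ∫ r in Set.Ioi (0:ℝ),
      (ω * (w r * (w r / r)) + deriv w r * (deriv w r / r)) := by
    refine setIntegral_nonneg measurableSet_Ioi fun r hr => ?_
    have hr0 : 0 < r := hr
    have h : ∀ x : ℝ, 0 ≤ x * (x / r) := fun x => by
      rw [← mul_div_assoc]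
      exact div_nonneg (mul_self_nonneg x) hr0.le
    exact add_nonneg (mul_nonneg hω.le (h _)) (h _)
  have key : ∫ r in Set.Ioi (0:ℝ),
        (deriv (deriv w) r + deriv w r / r - ω * w r - ((ε * r) ^ 2)⁻¹ * w r) ^ 2 * r =
      ∫ r in Set.Ioi (0:ℝ), ((ω * w r - deriv (deriv w) r - deriv w r / r) ^ 2 * r +
        ((ε ^ 4)⁻¹ - 4 * (ε ^ 2)⁻¹) * ((r ^ 4)⁻¹ * w r ^ 2 * r) +
        2 * (ε ^ 2)⁻¹ * (ω * (w r * (w r / r)) + deriv w r * (deriv w r / r)) -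
        2 * (ε ^ 2)⁻¹ * deriv G r) := by
    refine setIntegral_congr_fun measurableSet_Ioi fun r hr => ?_
    have hr0 : r ≠ 0 := (Set.mem_Ioi.mp hr).ne'
    simp only [hGd r hr]
    field_simp
    ring
  have iAB : IntegrableOn (fun r => (ω * w r - deriv (deriv w) r - deriv w r / r) ^ 2 * r +
      ((ε ^ 4)⁻¹ - 4 * (ε ^ 2)⁻¹) * ((r ^ 4)⁻¹ * w r ^ 2 * r)) (Set.Ioi 0) :=
    iA.add (iB.const_mul _)
  have iABQ : IntegrableOn (fun r => (ω * w r - deriv (deriv w) r - deriv w r / r) ^ 2 * r +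
      ((ε ^ 4)⁻¹ - 4 * (ε ^ 2)⁻¹) * ((r ^ 4)⁻¹ * w r ^ 2 * r) +
      2 * (ε ^ 2)⁻¹ * (ω * (w r * (w r / r)) + deriv w r * (deriv w r / r))) (Set.Ioi 0) :=
    iAB.add (iQ.const_mul _)
  rw [key, integral_sub iABQ (iG.const_mul _), integral_add iAB (iQ.const_mul _),
    integral_add iA (iB.const_mul _)]
  simp only [integral_const_mul, hG0]
  have : 0 ≤ 2 * (ε ^ 2)⁻¹ * ∫ r in Set.Ioi (0:ℝ),
      (ω * (w r * (w r / r)) + deriv w r * (deriv w r / r)) := by positivity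
  linarith
end

section
/- Let ω>0 and 0<ε<1/2. If u ∈ C²((0,∞), ℝ) satisfies ∫₀^∞ u(r)² r dr < ∞, ∫₀^∞ (u''(r) + u'(r)/r)² r dr < ∞, ∫₀^∞ r^{−4} u(r)² r dr < ∞, and u''(r) + u'(r)/r − ω·u(r) − (εr)^{−2}·u(r) = 0 for all r ∈ (0,∞), then u ≡ 0. (Kernel triviality of the self-adjoint operator 𝓛₀(ε) = Δ_r − ω − (εr)^{−2} on its natural domain.) -/
open MeasureTheory Real Filter

theorem stmt12 (ω ε : ℝ) (hω : 0 < ω) (hε0 : 0 < ε) (hε : ε < 1 / 2)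
    (u : ℝ → ℝ) (hreg : ContDiffOn ℝ 2 u (Set.Ioi 0))
    (h1 : IntegrableOn (fun r => u r ^ 2 * r) (Set.Ioi 0))
    (h2 : IntegrableOn
      (fun r => (deriv (deriv u) r + deriv u r / r) ^ 2 * r) (Set.Ioi 0))
    (h3 : IntegrableOn (fun r => (r ^ 4)⁻¹ * u r ^ 2 * r) (Set.Ioi 0))
    (hode : ∀ r ∈ Set.Ioi (0:ℝ),
      deriv (deriv u) r + deriv u r / r - ω * u r - ((ε * r) ^ 2)⁻¹ * u r = 0) :
    ∀ r ∈ Set.Ioi (0:ℝ), u r = 0 := by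
  have hu : ∀ r : ℝ, 0 < r → HasDerivAt u (deriv u r) r := fun r hr =>
    ((hreg.differentiableOn (by norm_num)).differentiableAt (Ioi_mem_nhds hr)).hasDerivAt
  have hu' : ∀ r : ℝ, 0 < r → HasDerivAt (deriv u) (deriv (deriv u) r) r := fun r hr =>
    (((hreg.deriv_of_isOpen (m := 1) isOpen_Ioi (by norm_num)).differentiableOn
      (by norm_num)).differentiableAt (Ioi_mem_nhds hr)).hasDerivAt
  have hsq : ∀ r : ℝ, 0 < r → HasDerivAt (fun s => u s ^ 2) (2 * u r * deriv u r) r :=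
    fun r hr => by simpa using (hu r hr).fun_pow 2
  -- The flux `r u u'` is nondecreasing by the equation; integrability forces it to vanish.
  have hG : ∀ r : ℝ, 0 < r → HasDerivAt (fun s => s * (u s * deriv u s))
      (r * deriv u r ^ 2 + r * (ω + ((ε * r) ^ 2)⁻¹) * u r ^ 2) r := fun r hr => by
    refine ((hasDerivAt_id' r).fun_mul ((hu r hr).fun_mul (hu' r hr))).congr_deriv ?_
    have h : deriv (deriv u) r = (ω + ((ε * r) ^ 2)⁻¹) * u r - deriv u r / r := by
      linarith [hode r hr]
    rw [h]
    generalize ((ε * r) ^ 2)⁻¹ = a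
    field_simp
    ring
  have hmono : MonotoneOn (fun s => s * (u s * deriv u s)) (Set.Ioi 0) := by
    refine monotoneOn_of_deriv_nonneg (convex_Ioi 0)
      (fun r hr => (hG r hr).continuousAt.continuousWithinAt) ?_ ?_
    · rw [interior_Ioi]
      exact fun r hr => (hG r hr).differentiableAt.differentiableWithinAt
    · rw [interior_Ioi]
      intro r hr
      have hr : 0 < r := hr
      rw [(hG r hr).deriv]
      positivity
  have hzero : ∀ r : ℝ, 0 < r → r * (u r * deriv u r) = 0 := by
    intro a ha
    rcases lt_trichotomy (a * (u a * deriv u a)) 0 with h | h | h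
    · exfalso
      have hua : u a ≠ 0 := by rintro h0; simp [h0] at h
      have hanti : AntitoneOn (fun s => u s ^ 2) (Set.Ioc 0 a) := by
        refine antitoneOn_of_deriv_nonpos (convex_Ioc 0 a)
          (fun r hr => (hsq r hr.1).continuousAt.continuousWithinAt) ?_ ?_
        · rw [interior_Ioc]
          exact fun r hr => (hsq r hr.1).differentiableAt.differentiableWithinAt
        · rw [interior_Ioc]
          intro r hr
          rw [(hsq r hr.1).deriv]
          have h' := (hmono (Set.mem_Ioi.2 hr.1) (Set.mem_Ioi.2 ha) hr.2.le).trans_lt h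
          have := neg_of_mul_neg_right h' hr.1.le
          linarith
      have hint : IntegrableOn (fun r : ℝ => u a ^ 2 * r ^ (-3 : ℝ)) (Set.Ioo 0 a) := by
        refine (h3.mono_set Set.Ioo_subset_Ioi_self).mono' (by fun_prop) ?_
        filter_upwards [ae_restrict_mem measurableSet_Ioo] with r hr
        have hr0 : 0 < r := hr.1
        have hle : u a ^ 2 ≤ u r ^ 2 := hanti ⟨hr.1, hr.2.le⟩ ⟨ha, le_rfl⟩ hr.2.le
        have hpow : r ^ (-3 : ℝ) = (r ^ 4)⁻¹ * r := by
          rw [rpow_neg hr0.le]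
          norm_cast
          field_simp
        rw [hpow, Real.norm_of_nonneg (by positivity)]
        calc u a ^ 2 * ((r ^ 4)⁻¹ * r) ≤ u r ^ 2 * ((r ^ 4)⁻¹ * r) := by gcongr
          _ = _ := by ring
      have hint' : IntegrableOn (fun r : ℝ => r ^ (-3 : ℝ)) (Set.Ioo 0 a) :=
        (integrable_const_mul_iff (by simpa using hua) _).1 hint
      rw [intervalIntegral.integrableOn_Ioo_rpow_iff ha] at hint'
      norm_num at hint'
    · exact h
    · exfalso
      have hua : u a ≠ 0 := by rintro h0; simp [h0] at h
      have hpos : ∀ r, a ≤ r → 0 < r := fun r hr => ha.trans_le hr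
      have hmon : MonotoneOn (fun s => u s ^ 2) (Set.Ici a) := by
        refine monotoneOn_of_deriv_nonneg (convex_Ici a)
          (fun r hr => (hsq r (hpos r hr)).continuousAt.continuousWithinAt) ?_ ?_
        · rw [interior_Ici]
          exact fun r hr => (hsq r (ha.trans hr)).differentiableAt.differentiableWithinAt
        · rw [interior_Ici]
          intro r hr
          have hr0 : 0 < r := ha.trans hr
          rw [(hsq r hr0).deriv]
          have h' := h.trans_le (hmono (Set.mem_Ioi.2 ha) (Set.mem_Ioi.2 hr0) (le_of_lt hr))
          have := pos_of_mul_pos_right h' hr0.le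
          linarith
      have hint : IntegrableOn (fun _ : ℝ => u a ^ 2 * a) (Set.Ioi a) := by
        refine (h1.mono_set (Set.Ioi_subset_Ioi ha.le)).mono' (by fun_prop) ?_
        filter_upwards [ae_restrict_mem measurableSet_Ioi] with r hr
        have hle : u a ^ 2 ≤ u r ^ 2 := hmon Set.self_mem_Ici (Set.Ioi_subset_Ici_self hr) (le_of_lt hr)
        rw [Real.norm_of_nonneg (by positivity)]
        exact mul_le_mul hle (le_of_lt hr) ha.le (sq_nonneg _)
      rw [integrableOn_const_iff] at hint
      simp [hua, ha.ne'] at hint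
  intro r hr
  have hr : 0 < r := hr
  have hd := (hG r hr).unique ((hasDerivAt_const r (0 : ℝ)).congr_of_eventuallyEq
    (eventually_of_mem (Ioi_mem_nhds hr) hzero))
  by_contra hne
  have : 0 < r * deriv u r ^ 2 + r * (ω + ((ε * r) ^ 2)⁻¹) * u r ^ 2 := by positivity
  exact this.ne' hd
end
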